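/- arXiv:2506.13125 — 3 statements merged into one kernel-verified Lean document; each statement's English description precedes it below -/
import Mathlib

section
/- Let A be a finite nonempty set of arms with true mean vectors μ : A → ℝ^D and empirical mean vectors μ̄ : A → ℝ^D, and let r ≥ 0. Suppose every arm is clean with radius r (|μ̄(a)_d − μ(a)_d| ≤ r for all a ∈ A and d ∈ [D]). Then for every arm a ∈ A there exists an arm a* ∈ A that is Pareto-optimal with respect to μ and satisfies μ̄(a*)_d + 2r ≥ μ̄(a)_d for all d ∈ [D]. -/
/-- Under the clean event, every arm is approximately covered (in empirical means,
after improving by `2r`) by some Pareto-optimal arm. -/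
theorem exists_pareto_empirical_cover {α : Type*} (D : ℕ) (hD : 0 < D)
    (A : Finset α) (hA : A.Nonempty)
    (μ μ' : α → Fin D → ℝ) (r : ℝ) (hr : 0 ≤ r)
    (hclean : ∀ a ∈ A, ∀ d : Fin D, |μ' a d - μ a d| ≤ r) :
    ∀ a ∈ A, ∃ astar ∈ A,
      (¬ ∃ b ∈ A, (∀ d : Fin D, μ astar d ≤ μ b d) ∧ (∃ d : Fin D, μ astar d < μ b d)) ∧
      (∀ d : Fin D, μ' a d ≤ μ' astar d + 2 * r) := by
  classical
  intro a ha
  obtain ⟨v, hav, hv⟩ :=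
    (A.image μ).finite_toSet.exists_le_maximal (Finset.mem_image_of_mem μ ha)
  obtain ⟨x, hx, rfl⟩ := Finset.mem_image.mp hv.prop
  refine ⟨x, hx, ?_, fun d => ?_⟩
  · rintro ⟨b, hb, hle, d, hd⟩
    exact (hv.le_of_ge (Finset.mem_image_of_mem μ hb) hle d).not_gt hd
  · have h₁ := (abs_le.mp (hclean a ha d)).2
    have h₂ := (abs_le.mp (hclean x hx d)).1
    have h₃ := hav d
    linarith
end

section
/- Let A be a finite nonempty set of arms with true mean vectors μ : A → ℝ^D and empirical mean vectors μ̄ : A → ℝ^D, let r ≥ 0, and suppose every arm is clean with radius r (|μ̄(a)_d − μ(a)_d| ≤ r for all a ∈ A and d ∈ [D]). Let A* ⊆ A denote the set of arms that are Pareto-optimal with respect to μ. Then there exists a subset B ⊆ A with |B| ≤ |A*| such that for every a ∈ A there is some b ∈ B with μ̄(b)_d + 2r ≥ μ̄(a)_d for all d ∈ [D]; consequently, any minimum-cardinality subset of A with this covering property has size at most |A*|. -/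
open Classical in
/-- Every element of a finite set lies below one whose image under `f` is maximal. -/
theorem Finset.exists_le_not_exists_lt {α β : Type*} [PartialOrder β] (A : Finset α)
    (f : α → β) {a : α} (ha : a ∈ A) :
    ∃ b ∈ A, f a ≤ f b ∧ ¬ ∃ c ∈ A, f b < f c := by
  obtain ⟨m, hm, hmax⟩ := (A.image f).exists_le_maximal (Finset.mem_image_of_mem f ha)
  obtain ⟨b, hb, rfl⟩ := Finset.mem_image.mp hmax.prop
  exact ⟨b, hb, hm, fun ⟨c, hc, hlt⟩ => hmax.not_gt (Finset.mem_image_of_mem f hc) hlt⟩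

open Classical in
/-- Under the clean event, there is a covering set `B` of size at most the number of
Pareto-optimal arms; consequently, any minimum-cardinality covering set has size at
most the number of Pareto-optimal arms. -/
theorem min_set_cover_le_pareto_card {α : Type*} (D : ℕ) (hD : 0 < D)
    (A : Finset α) (hA : A.Nonempty)
    (μ μ' : α → Fin D → ℝ) (r : ℝ) (hr : 0 ≤ r)
    (hclean : ∀ a ∈ A, ∀ d : Fin D, |μ' a d - μ a d| ≤ r) :
    (∃ B ⊆ A,
      B.card ≤ (A.filter (fun a =>
        ¬ ∃ b ∈ A, (∀ d : Fin D, μ a d ≤ μ b d) ∧ (∃ d : Fin D, μ a d < μ b d))).card ∧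
      ∀ a ∈ A, ∃ b ∈ B, ∀ d : Fin D, μ' a d ≤ μ' b d + 2 * r) ∧
    (∀ C ⊆ A,
      (∀ a ∈ A, ∃ b ∈ C, ∀ d : Fin D, μ' a d ≤ μ' b d + 2 * r) →
      (∀ C' ⊆ A,
        (∀ a ∈ A, ∃ b ∈ C', ∀ d : Fin D, μ' a d ≤ μ' b d + 2 * r) →
        C.card ≤ C'.card) →
      C.card ≤ (A.filter (fun a =>
        ¬ ∃ b ∈ A, (∀ d : Fin D, μ a d ≤ μ b d) ∧ (∃ d : Fin D, μ a d < μ b d))).card) := by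
  have hcover : ∀ a ∈ A, ∃ b ∈ A.filter (fun a =>
      ¬ ∃ b ∈ A, (∀ d : Fin D, μ a d ≤ μ b d) ∧ (∃ d : Fin D, μ a d < μ b d)),
      ∀ d : Fin D, μ' a d ≤ μ' b d + 2 * r := by
    intro a ha
    obtain ⟨b, hb, hab, hopt⟩ := A.exists_le_not_exists_lt μ ha
    refine ⟨b, Finset.mem_filter.mpr ⟨hb, ?_⟩, fun d => ?_⟩
    · rintro ⟨c, hc, hle, hlt⟩
      exact hopt ⟨c, hc, Pi.lt_def.mpr ⟨hle, hlt⟩⟩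
    · have h₁ := (abs_le.mp (hclean a ha d)).2
      have h₂ := (abs_le.mp (hclean b hb d)).1
      have h₃ := hab d
      linarith
  exact ⟨⟨_, Finset.filter_subset _ _, le_rfl, hcover⟩,
    fun C _ _ hmin => hmin _ (Finset.filter_subset _ _) hcover⟩
end

section
/- Let n ≥ 1 and D ≥ 1, let μ : {1,...,n} → ℝ^D assign a reward vector to each arm, and let v ∈ ℝ^D. Suppose there exist weights w_1, ..., w_n ≥ 0 with w_1 + ... + w_n = 1 such that Σ_{i=1}^n w_i μ(i)_d > v_d for every coordinate d ∈ [D]. Then there exist a sequence of arms S : ℕ → {1,...,n} and a round T_0 ∈ ℕ such that for every T ≥ T_0 and every d ∈ [D], the cumulative reward Σ_{t=1}^T μ(S(t))_d ≥ T · v_d. -/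
open Finset in
/-- Given weights summing to one, there is a sequence of elements whose visit counts up to any
time `T` stay within a bounded distance of `T * w i`. The function `x T i` is the deficit
`T * w i - #{t < T | S t = i}`, expressed through its effect on cumulative sums. -/
theorem exists_seq_bounded_deficit {ι : Type*} [Fintype ι] [Nonempty ι] (w : ι → ℝ)
    (hw : ∀ i, 0 ≤ w i) (hw1 : ∑ i, w i = 1) :
    ∃ (S : ℕ → ι) (x : ℕ → ι → ℝ), (∀ T i, |x T i| ≤ Fintype.card ι) ∧
      ∀ (f : ι → ℝ) (T : ℕ), ∑ t ∈ range T, f (S t) = ∑ i, (T * w i - x T i) * f i := by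
  classical
  have hpos : ∀ y : ι → ℝ, ∃ j, ∑ i, y i = 0 → 0 < y j + w j := by
    intro y
    by_contra! h
    have h0 : ∑ i, y i = 0 := (h (Classical.arbitrary ι)).1
    have hle : ∑ i, (y i + w i) ≤ 0 := sum_nonpos fun i _ => (h i).2
    rw [sum_add_distrib, h0, hw1] at hle
    linarith
  choose g hg using hpos
  let x : ℕ → ι → ℝ := fun T =>
    Nat.rec 0 (fun _ y i => y i + w i - if i = g y then 1 else 0) T
  have hx0 : ∀ i, x 0 i = 0 := fun _ => rfl
  have hxs : ∀ T i, x (T + 1) i = x T i + w i - if i = g (x T) then 1 else 0 := fun _ _ => rfl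
  have hsum : ∀ T, ∑ i, x T i = 0 := by
    intro T
    induction T with
    | zero => simp [hx0]
    | succ T ih => simp [hxs, sum_sub_distrib, sum_add_distrib, ih, hw1]
  have hlow : ∀ T i, -1 ≤ x T i := by
    intro T
    induction T with
    | zero => simp [hx0]
    | succ T ih =>
      intro i
      rw [hxs]
      split_ifs with h
      · have := hg (x T) (hsum T)
        rw [← h] at this
        linarith
      · linarith [ih i, hw i]
  refine ⟨fun t => g (x t), x, fun T i => ?_, fun f T => ?_⟩
  · have hcard : (1 : ℝ) ≤ Fintype.card ι := by exact_mod_cast Fintype.card_pos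
    have hup : x T i + 1 ≤ ∑ j, (x T j + 1) :=
      single_le_sum (f := fun j => x T j + 1) (fun j _ => by linarith [hlow T j]) (mem_univ i)
    rw [sum_add_distrib, hsum T] at hup
    simp only [sum_const, card_univ, nsmul_eq_mul, mul_one, zero_add] at hup
    exact abs_le.2 ⟨by linarith [hlow T i], by linarith⟩
  · induction T with
    | zero => simp [hx0]
    | succ T ih =>
      have hstep : ∀ i, ((T + 1 : ℕ) * w i - x (T + 1) i) * f i
          = (T * w i - x T i) * f i + if i = g (x T) then f i else 0 := by
        intro i
        rw [hxs]
        push_cast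
        split_ifs <;> ring
      rw [sum_range_succ, ih, sum_congr rfl fun i _ => hstep i, sum_add_distrib]
      simp

/-- If a convex combination of the arms' reward vectors strictly exceeds `v` in every
coordinate, then there is a sequence of arm pulls whose cumulative reward weakly
dominates `T·v` for all sufficiently large horizons `T`. -/
theorem convex_combination_cumulative_domination (n D : ℕ) (hn : 1 ≤ n) (hD : 1 ≤ D)
    (μ : Fin n → Fin D → ℝ) (v : Fin D → ℝ)
    (hconv : ∃ w : Fin n → ℝ, (∀ i, 0 ≤ w i) ∧ (∑ i, w i) = 1 ∧
      ∀ d : Fin D, v d < ∑ i, w i * μ i d) :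
    ∃ (S : ℕ → Fin n) (T₀ : ℕ), ∀ T ≥ T₀, ∀ d : Fin D,
      (T : ℝ) * v d ≤ ∑ t ∈ Finset.range T, μ (S t) d := by
  obtain ⟨w, hw, hw1, hv⟩ := hconv
  have : Nonempty (Fin n) := ⟨⟨0, hn⟩⟩
  obtain ⟨S, x, hx, hS⟩ := exists_seq_bounded_deficit w hw hw1
  have hev : ∀ᶠ T : ℕ in Filter.atTop, ∀ d : Fin D,
      ∑ i, n * |μ i d| ≤ (T : ℝ) * (∑ i, w i * μ i d - v d) :=
    Filter.eventually_all.2 fun d =>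
      (tendsto_natCast_atTop_atTop.atTop_mul_const (sub_pos.2 (hv d))).eventually_ge_atTop _
  obtain ⟨T₀, hT₀⟩ := Filter.eventually_atTop.1 hev
  refine ⟨S, T₀, fun T hT d => ?_⟩
  have hbound : ∑ i, x T i * μ i d ≤ ∑ i, n * |μ i d| := by
    refine Finset.sum_le_sum fun i _ => (le_abs_self _).trans ?_
    rw [abs_mul]
    exact mul_le_mul_of_nonneg_right (by simpa using hx T i) (abs_nonneg _)
  have hsum : ∑ t ∈ Finset.range T, μ (S t) d
      = T * ∑ i, w i * μ i d - ∑ i, x T i * μ i d := by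
    rw [hS (fun i => μ i d) T, Finset.mul_sum, ← Finset.sum_sub_distrib]
    exact Finset.sum_congr rfl fun i _ => by ring
  rw [hsum]
  linarith [hT₀ T hT d]
end
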